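/- arXiv:2405.09815 — 3 statements merged into one kernel-verified Lean document; each statement's English description precedes it below -/
import Mathlib

section
/- Let X be a compact metric space and let A₁ and A₂ be closed subalgebras of C(X) containing the constants. A function u₀ ∈ A₁ + A₂ is a best approximation to a function f ∈ C(X) \ (A₁ + A₂), i.e., ‖f − u₀‖ = E(f), if and only if there exists a closed or infinite bolt with respect to A₁ and A₂ that is extremal for the function f − u₀. -/
open Filter Topology

/-- Two points `a, b` of `X` are linked via the algebra `A ⊆ C(X)` if every
element of `A` takes equal values at `a` and `b`. -/
def AlgLink {X : Type*} [TopologicalSpace X] (A : Subalgebra ℝ C(X, ℝ)) (a b : X) : Prop :=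
  ∀ g : C(X, ℝ), g ∈ A → g a = g b

/-- `x 0, x 1, ..., x (n-1)` is a finite (lightning) bolt with respect to the
algebras `A₁, A₂`: consecutive points are distinct and the consecutive links
alternate between `A₁`-links and `A₂`-links (in one of the two possible orders). -/
def IsFiniteBolt {X : Type*} [TopologicalSpace X] (A₁ A₂ : Subalgebra ℝ C(X, ℝ)) {n : ℕ}
    (x : Fin n → X) : Prop :=
  (∀ (i : ℕ) (h : i + 1 < n), x ⟨i, Nat.lt_of_succ_lt h⟩ ≠ x ⟨i + 1, h⟩) ∧
  ((∀ (i : ℕ) (h : i + 1 < n),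
      if Even i then AlgLink A₁ (x ⟨i, Nat.lt_of_succ_lt h⟩) (x ⟨i + 1, h⟩)
      else AlgLink A₂ (x ⟨i, Nat.lt_of_succ_lt h⟩) (x ⟨i + 1, h⟩)) ∨
   (∀ (i : ℕ) (h : i + 1 < n),
      if Even i then AlgLink A₂ (x ⟨i, Nat.lt_of_succ_lt h⟩) (x ⟨i + 1, h⟩)
      else AlgLink A₁ (x ⟨i, Nat.lt_of_succ_lt h⟩) (x ⟨i + 1, h⟩)))

/-- The cyclically next index in `Fin m`. -/
def nextIdx {m : ℕ} (i : Fin m) : Fin m := ⟨((i : ℕ) + 1) % m, Nat.mod_lt _ i.pos⟩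

/-- `x 0, ..., x (m-1)` is a closed bolt with respect to `A₁, A₂`: the number of
points is even and positive, cyclically consecutive points are distinct, and the
cyclic links alternate between `A₁`-links and `A₂`-links. -/
def IsClosedBolt {X : Type*} [TopologicalSpace X] (A₁ A₂ : Subalgebra ℝ C(X, ℝ)) {m : ℕ}
    (x : Fin m → X) : Prop :=
  0 < m ∧ Even m ∧
  (∀ i : Fin m, x i ≠ x (nextIdx i)) ∧
  ((∀ i : Fin m, if Even (i : ℕ) then AlgLink A₁ (x i) (x (nextIdx i))
      else AlgLink A₂ (x i) (x (nextIdx i))) ∨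
   (∀ i : Fin m, if Even (i : ℕ) then AlgLink A₂ (x i) (x (nextIdx i))
      else AlgLink A₁ (x i) (x (nextIdx i))))

/-- `x 0, x 1, x 2, ...` is an infinite bolt with respect to `A₁, A₂`. -/
def IsInfiniteBolt {X : Type*} [TopologicalSpace X] (A₁ A₂ : Subalgebra ℝ C(X, ℝ))
    (x : ℕ → X) : Prop :=
  (∀ i : ℕ, x i ≠ x (i + 1)) ∧
  ((∀ i : ℕ, if Even i then AlgLink A₁ (x i) (x (i + 1)) else AlgLink A₂ (x i) (x (i + 1))) ∨
   (∀ i : ℕ, if Even i then AlgLink A₂ (x i) (x (i + 1)) else AlgLink A₁ (x i) (x (i + 1))))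

/-- The bolt functional `r_l(F) = (1/n) ∑_{i=1}^n (-1)^{i+1} F(xᵢ)` associated with
the finite bolt `l = {x 0, ..., x (n-1)}` (here indexed from `0`). -/
noncomputable def boltFun {X : Type*} [TopologicalSpace X] {n : ℕ} (x : Fin n → X)
    (F : C(X, ℝ)) : ℝ :=
  (n : ℝ)⁻¹ * ∑ i : Fin n, (-1 : ℝ) ^ (i : ℕ) * F (x i)

/-- The set `A₁ + A₂ = {u₁ + u₂ : u₁ ∈ A₁, u₂ ∈ A₂}`. -/
def algSum {X : Type*} [TopologicalSpace X] (A₁ A₂ : Subalgebra ℝ C(X, ℝ)) : Set C(X, ℝ) :=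
  {u | ∃ u₁ ∈ A₁, ∃ u₂ ∈ A₂, u = u₁ + u₂}

/-- The approximation error `E(f) = inf_{u ∈ A₁+A₂} ‖f - u‖`. -/
noncomputable def approxError {X : Type*} [TopologicalSpace X] [CompactSpace X]
    (A₁ A₂ : Subalgebra ℝ C(X, ℝ)) (f : C(X, ℝ)) : ℝ :=
  ⨅ u : algSum A₁ A₂, ‖f - (u : C(X, ℝ))‖

/-- A finite bolt `x 0, ..., x (n-1)` is extremal for `h ∈ C(X)` if
`h (x i) = (-1)^i ‖h‖` for all `i`, or `h (x i) = (-1)^{i+1} ‖h‖` for all `i`. -/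
def ExtremalFin {X : Type*} [TopologicalSpace X] [CompactSpace X] {n : ℕ}
    (h : C(X, ℝ)) (x : Fin n → X) : Prop :=
  (∀ i : Fin n, h (x i) = (-1 : ℝ) ^ (i : ℕ) * ‖h‖) ∨
  (∀ i : Fin n, h (x i) = (-1 : ℝ) ^ ((i : ℕ) + 1) * ‖h‖)

/-- An infinite bolt `x 0, x 1, ...` is extremal for `h ∈ C(X)` if
`h (x i) = (-1)^i ‖h‖` for all `i`, or `h (x i) = (-1)^{i+1} ‖h‖` for all `i`. -/
def ExtremalSeq {X : Type*} [TopologicalSpace X] [CompactSpace X]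
    (h : C(X, ℝ)) (x : ℕ → X) : Prop :=
  (∀ i : ℕ, h (x i) = (-1 : ℝ) ^ i * ‖h‖) ∨
  (∀ i : ℕ, h (x i) = (-1 : ℝ) ^ (i + 1) * ‖h‖)

section BoltExistence

variable {X : Type*} [TopologicalSpace X] [CompactSpace X]

/-- The points at which a continuous function attains its norm in absolute value. -/
def peakSet (h : C(X, ℝ)) : Set X := {x | |h x| = ‖h‖}

/-- The set of points at which every nonnegative `F` with `L (h * F) ≤ 0` vanishes: the support of
the functional `F ↦ L (h * F)` when it is positive. -/
def weightedSupport (h : C(X, ℝ)) (L : C(X, ℝ) →L[ℝ] ℝ) : Set X :=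
  {x | ∀ F : C(X, ℝ), (∀ y, 0 ≤ F y) → L (h * F) ≤ 0 → F x ≤ 0}

theorem isCompact_weightedSupport (h : C(X, ℝ)) (L : C(X, ℝ) →L[ℝ] ℝ) :
    IsCompact (weightedSupport h L) := by
  apply IsClosed.isCompact
  simp only [weightedSupport, Set.ofPred_forall]
  exact isClosed_iInter fun F => isClosed_iInter fun _ => isClosed_iInter fun _ =>
    isClosed_le F.continuous continuous_const

/-- A point not linked to any point of a compact set is separated from it by a nonnegative element
of the closed subalgebra. -/
theorem exists_nonneg_mem_vanishing (A : Subalgebra ℝ C(X, ℝ))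
    (hA : IsClosed (A : Set C(X, ℝ))) {K : Set X} (hK : IsCompact K) (x : X)
    (hx : ∀ y ∈ K, ¬ AlgLink A x y) :
    ∃ g ∈ A, (∀ y, 0 ≤ g y) ∧ 0 < g x ∧ ∀ y ∈ K, g y = 0 := by
  have hq : ∃ q ∈ A, (∀ y, 0 ≤ q y) ∧ q x = 0 ∧ ∀ y ∈ K, 0 < q y := by
    refine hK.induction_on
      (p := fun s => ∃ q ∈ A, (∀ y, 0 ≤ q y) ∧ q x = 0 ∧ ∀ y ∈ s, 0 < q y) ?_ ?_ ?_ ?_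
    · exact ⟨0, A.zero_mem, by simp, by simp, by simp⟩
    · rintro s t hst ⟨q, hqA, h0, h1, h2⟩
      exact ⟨q, hqA, h0, h1, fun y hy => h2 y (hst hy)⟩
    · rintro s t ⟨q, hqA, h0, h1, h2⟩ ⟨r, hrA, k0, k1, k2⟩
      refine ⟨q + r, A.add_mem hqA hrA, fun y => add_nonneg (h0 y) (k0 y), by simp [h1, k1], ?_⟩
      rintro y (hy | hy)
      · exact add_pos_of_pos_of_nonneg (h2 y hy) (k0 y)
      · exact add_pos_of_nonneg_of_pos (h0 y) (k2 y hy)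
    · intro y hy
      have := hx y hy
      simp only [AlgLink, not_forall] at this
      obtain ⟨g, hg, hne⟩ := this
      set r : C(X, ℝ) := g - algebraMap ℝ C(X, ℝ) (g x) with hr
      have hrv : ∀ z, r z = g z - g x := fun z => by simp [hr]
      refine ⟨{z | r z ≠ 0}, mem_nhdsWithin_of_mem_nhds ?_, r * r,
        A.mul_mem (A.sub_mem hg (A.algebraMap_mem _)) (A.sub_mem hg (A.algebraMap_mem _)),
        fun z => mul_self_nonneg _, by simp [hrv], fun z hz => mul_self_pos.2 hz⟩
      refine (isOpen_ne_fun r.continuous continuous_const).mem_nhds ?_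
      simpa [hrv, sub_eq_zero] using fun h => hne h.symm
  obtain ⟨q, hqA, -, hqx, hqK⟩ := hq
  obtain ⟨δ, hδ, hδK⟩ : ∃ δ : ℝ, 0 < δ ∧ ∀ y ∈ K, δ ≤ q y := by
    rcases K.eq_empty_or_nonempty with rfl | hne
    · exact ⟨1, one_pos, by simp⟩
    · obtain ⟨z, hz, hmin⟩ := hK.exists_isMinOn hne q.continuous.continuousOn
      exact ⟨q z, hqK z hz, fun y hy => hmin hy⟩
  have hmem := ContinuousMap.sup_mem_closed_subalgebra A hA
    ⟨algebraMap ℝ C(X, ℝ) δ - q, A.sub_mem (A.algebraMap_mem _) hqA⟩ ⟨0, A.zero_mem⟩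
  refine ⟨_, hmem, fun y => ?_, ?_, fun y hy => ?_⟩
  · simp
  · simp [hqx, hδ]
  · simpa using hδK y hy

/-- Kolmogorov's criterion: subtracting a small multiple of a function having the same sign as `h`
on the peak set of `h` decreases the norm. -/
theorem exists_norm_sub_smul_lt {h u : C(X, ℝ)} (h0 : h ≠ 0)
    (hu : ∀ x ∈ peakSet h, 0 < h x * u x) : ∃ t : ℝ, ‖h - t • u‖ < ‖h‖ := by
  have key : ∀ᶠ t : ℝ in 𝓝[>] 0, ∀ x ∈ (Set.univ : Set X), (h x - t * u x) ^ 2 < ‖h‖ ^ 2 := by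
    rw [eventually_nhdsWithin_iff]
    suffices ∀ᶠ t : ℝ in 𝓝 0, ∀ x ∈ (Set.univ : Set X),
        t ∈ Set.Ioi 0 → (h x - t * u x) ^ 2 < ‖h‖ ^ 2 by
      filter_upwards [this] with t ht hpos x hx using ht x hx hpos
    refine isCompact_univ.eventually_forall_of_forall_eventually fun x _ => ?_
    by_cases hx : x ∈ peakSet h
    · have : ∀ᶠ z : ℝ × X in 𝓝 (0, x), 0 < 2 * (h z.2 * u z.2) - z.1 * u z.2 ^ 2 := by
        refine ContinuousAt.eventually_lt (by fun_prop) (by fun_prop) ?_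
        simpa using hu x hx
      filter_upwards [this] with z hz hpos
      have h1 : h z.2 ^ 2 ≤ ‖h‖ ^ 2 := sq_le_sq.2 (by simpa using h.norm_coe_le_norm z.2)
      nlinarith [mul_pos (Set.mem_Ioi.1 hpos) hz]
    · have : ∀ᶠ z : ℝ × X in 𝓝 (0, x), (h z.2 - z.1 * u z.2) ^ 2 < ‖h‖ ^ 2 := by
        refine ContinuousAt.eventually_lt (by fun_prop) (by fun_prop) ?_
        have := lt_of_le_of_ne (h.norm_coe_le_norm x) hx
        simpa using sq_lt_sq.2 (by simpa using this)
      filter_upwards [this] with z hz _ using hz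
  obtain ⟨t, ht⟩ := key.exists
  refine ⟨t, (ContinuousMap.norm_lt_iff _ (norm_pos_iff.2 h0)).2 fun x => ?_⟩
  have := sq_lt_sq.1 (ht x trivial)
  simpa using this

/-- A nonzero function whose norm cannot be decreased by subtracting elements of a subspace admits
a functional annihilating the subspace and positive on functions with the sign of `h` on the peak
set. -/
theorem exists_annihilating_functional (V : Submodule ℝ C(X, ℝ)) {h : C(X, ℝ)} (h0 : h ≠ 0)
    (hV : ∀ u ∈ V, ‖h‖ ≤ ‖h - u‖) :
    ∃ L : C(X, ℝ) →L[ℝ] ℝ, (∀ u ∈ V, L u = 0) ∧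
      ∀ F : C(X, ℝ), (∀ x ∈ peakSet h, 0 < h x * F x) → 0 < L F := by
  set S : Set C(X, ℝ) := {F | ∀ x ∈ peakSet h, 0 < h x * F x} with hS
  have hSconv : Convex ℝ S := by
    intro F hF G hG a b ha hb hab x hx
    have h1 := hF x hx
    have h2 := hG x hx
    have : h x * (a • F + b • G) x = a * (h x * F x) + b * (h x * G x) := by
      simp; ring
    rw [this]
    rcases ha.eq_or_lt with rfl | ha
    · obtain rfl : b = 1 := by linarith
      simpa using h2
    · positivity
  have hpeak : IsCompact (peakSet h) :=
    (isClosed_eq (by fun_prop) continuous_const).isCompact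
  have hSopen : IsOpen S := by
    have := (ContinuousMap.isOpen_setOfPred_mapsTo hpeak (isOpen_Ioi (a := (0 : ℝ)))).preimage
      (continuous_const_mul h)
    exact this
  have hdisj : Disjoint S (V : Set C(X, ℝ)) := by
    rw [Set.disjoint_left]
    intro u hu huV
    obtain ⟨t, ht⟩ := exists_norm_sub_smul_lt h0 hu
    exact absurd (hV _ (V.smul_mem t huV)) (not_le.2 ht)
  obtain ⟨L, c, hLS, hLV⟩ := geometric_hahn_banach_open hSconv hSopen V.convex hdisj
  have hc : c ≤ 0 := by simpa using hLV 0 V.zero_mem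
  refine ⟨-L, fun u hu => ?_, fun F hF => ?_⟩
  · by_contra hne
    have hne' : L u ≠ 0 := by simpa using hne
    have := hLV _ (V.smul_mem ((c - 1) / L u) hu)
    simp [div_mul_cancel₀ _ hne'] at this
    linarith
  · have := hLS F hF
    simp only [neg_apply]
    linarith

variable {h : C(X, ℝ)} {L : C(X, ℝ) →L[ℝ] ℝ}

theorem mul_self_of_mem_peakSet {x : X} (hx : x ∈ peakSet h) : h x * h x = ‖h‖ * ‖h‖ := by
  rw [← abs_mul_abs_self, show |h x| = ‖h‖ from hx]

theorem self_pos_of_pos_of_peakSet (h0 : h ≠ 0)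
    (hL : ∀ F : C(X, ℝ), (∀ x ∈ peakSet h, 0 < h x * F x) → 0 < L F) : 0 < L h :=
  hL h fun x hx => by
    have := norm_pos_iff.2 h0
    rw [mul_self_of_mem_peakSet hx]
    positivity

theorem nonneg_of_nonneg_on_peakSet (h0 : h ≠ 0)
    (hL : ∀ F : C(X, ℝ), (∀ x ∈ peakSet h, 0 < h x * F x) → 0 < L F)
    {F : C(X, ℝ)} (hF : ∀ x ∈ peakSet h, 0 ≤ h x * F x) : 0 ≤ L F := by
  have hn := norm_pos_iff.2 h0
  have hh := self_pos_of_pos_of_peakSet h0 hL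
  refine le_of_forall_pos_lt_add fun ε hε => ?_
  have := hL (F + (ε / L h) • h) fun x hx => by
    have h1 := hF x hx
    have h2 := mul_self_of_mem_peakSet hx
    have : h x * (F + (ε / L h) • h) x = h x * F x + ε / L h * (h x * h x) := by
      simp; ring
    rw [this, h2]
    positivity
  simpa [div_mul_cancel₀ _ hh.ne'] using this

theorem nonneg_mul_of_nonneg_on_weightedSupport (h0 : h ≠ 0)
    (hL : ∀ F : C(X, ℝ), (∀ x ∈ peakSet h, 0 < h x * F x) → 0 < L F)
    {F : C(X, ℝ)} (hF : ∀ x ∈ weightedSupport h L, 0 ≤ F x) : 0 ≤ L (h * F) := by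
  have hh := self_pos_of_pos_of_peakSet h0 hL
  have hmono : ∀ G : C(X, ℝ), (∀ y, 0 ≤ G y) → 0 ≤ L (h * G) := fun G hG =>
    nonneg_of_nonneg_on_peakSet h0 hL fun x _ => by
      have : h x * (h * G) x = h x * h x * G x := by simp; ring
      rw [this]
      exact mul_nonneg (mul_self_nonneg _) (hG x)
  refine le_of_forall_pos_le_add fun ε hε => ?_
  set η := ε / L h with hη
  have hηpos : 0 < η := div_pos hε hh
  obtain ⟨G, hG0, hGL, hG⟩ : ∃ G : C(X, ℝ), (∀ y, 0 ≤ G y) ∧ L (h * G) ≤ 0 ∧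
      ∀ y ∈ (Set.univ : Set X), 0 ≤ F y + η + G y := by
    refine isCompact_univ.induction_on (p := fun s => ∃ G : C(X, ℝ), (∀ y, 0 ≤ G y) ∧
      L (h * G) ≤ 0 ∧ ∀ y ∈ s, 0 ≤ F y + η + G y) ?_ ?_ ?_ ?_
    · exact ⟨0, by simp, by simp, by simp⟩
    · rintro s t hst ⟨G, h1, h2, h3⟩
      exact ⟨G, h1, h2, fun y hy => h3 y (hst hy)⟩
    · rintro s t ⟨G, h1, h2, h3⟩ ⟨H, k1, k2, k3⟩
      refine ⟨G + H, fun y => add_nonneg (h1 y) (k1 y), ?_, ?_⟩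
      · rw [mul_add, map_add]
        linarith
      · rintro y (hy | hy)
        · have := h3 y hy
          have := k1 y
          simp only [ContinuousMap.add_apply]
          linarith
        · have := k3 y hy
          have := h1 y
          simp only [ContinuousMap.add_apply]
          linarith
    · intro x _
      by_cases hx : x ∈ weightedSupport h L
      · refine ⟨{y | 0 < F y + η}, mem_nhdsWithin_of_mem_nhds ?_, 0, by simp, by simp,
          fun y hy => by simpa using (show 0 < F y + η from hy).le⟩
        refine (isOpen_lt continuous_const (by fun_prop)).mem_nhds ?_
        have := hF x hx
        change 0 < F x + η
        linarith
      · simp only [weightedSupport, Set.mem_ofPred_eq, not_forall, not_le] at hx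
        obtain ⟨G, hG0, hGL, hGx⟩ := hx
        set c := (|F x| + 1) / G x with hc
        have hcpos : 0 ≤ c := by positivity
        refine ⟨{y | 0 < F y + η + c * G y}, mem_nhdsWithin_of_mem_nhds ?_, c • G,
          fun y => mul_nonneg hcpos (hG0 y), ?_,
          fun y hy => by simpa using (show 0 < F y + η + c * G y from hy).le⟩
        · refine (isOpen_lt continuous_const (by fun_prop)).mem_nhds ?_
          have h1 : c * G x = |F x| + 1 := div_mul_cancel₀ _ hGx.ne'
          have := neg_abs_le (F x)
          change 0 < F x + η + c * G x
          linarith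
        · rw [mul_smul_comm, map_smul]
          exact mul_nonpos_of_nonneg_of_nonpos hcpos hGL
  have := hmono (F + algebraMap ℝ C(X, ℝ) η + G) fun y => by simpa using hG y trivial
  have hmul : h * algebraMap ℝ C(X, ℝ) η = η • h := by
    rw [mul_comm, Algebra.smul_def]
  rw [mul_add, mul_add, map_add, map_add, hmul, map_smul, smul_eq_mul,
    div_mul_cancel₀ _ hh.ne'] at this
  linarith

theorem weightedSupport_nonempty (h0 : h ≠ 0)
    (hL : ∀ F : C(X, ℝ), (∀ x ∈ peakSet h, 0 < h x * F x) → 0 < L F) :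
    (weightedSupport h L).Nonempty := by
  by_contra hne
  rw [Set.not_nonempty_iff_eq_empty] at hne
  have h1 := nonneg_mul_of_nonneg_on_weightedSupport h0 hL (F := -1) (by simp [hne])
  have h2 := self_pos_of_pos_of_peakSet h0 hL
  rw [mul_neg, mul_one, map_neg] at h1
  linarith

theorem weightedSupport_subset_peakSet (h0 : h ≠ 0)
    (hL : ∀ F : C(X, ℝ), (∀ x ∈ peakSet h, 0 < h x * F x) → 0 < L F) :
    weightedSupport h L ⊆ peakSet h := by
  intro x hx
  have hle : ∀ y, |h y| ≤ ‖h‖ := fun y => h.norm_coe_le_norm y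
  set F : C(X, ℝ) := algebraMap ℝ C(X, ℝ) ‖h‖ - |h| with hF
  have hFv : ∀ y, F y = ‖h‖ - |h y| := fun y => by simp [hF]
  have hneg : 0 ≤ L (-(h * F)) := nonneg_of_nonneg_on_peakSet h0 hL fun y hy => by
    have : F y = 0 := by rw [hFv, show |h y| = ‖h‖ from hy, sub_self]
    simp [this]
  have := hx F (fun y => by rw [hFv]; linarith [hle y]) (by rw [map_neg] at hneg; linarith)
  rw [hFv] at this
  exact le_antisymm (hle x) (by linarith)

/-- Every point of the support is linked to a point of the support of opposite sign. -/
theorem exists_algLink_neg (h0 : h ≠ 0)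
    (hL : ∀ F : C(X, ℝ), (∀ x ∈ peakSet h, 0 < h x * F x) → 0 < L F)
    (A : Subalgebra ℝ C(X, ℝ)) (hA : IsClosed (A : Set C(X, ℝ))) (hLA : ∀ g ∈ A, L g = 0)
    {x : X} (hx : x ∈ weightedSupport h L) :
    ∃ y ∈ weightedSupport h L, AlgLink A x y ∧ h y = -h x := by
  by_contra! hno
  have hsub := weightedSupport_subset_peakSet h0 hL
  have hK : IsCompact (weightedSupport h L ∩ {y | h y = -h x}) :=
    (isCompact_weightedSupport h L).inter_right (isClosed_eq h.continuous continuous_const)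
  obtain ⟨g, hgA, hg0, hgx, hgK⟩ := exists_nonneg_mem_vanishing A hA hK x
    fun y hy hl => hno y hy.1 hl hy.2
  have hn := norm_pos_iff.2 h0
  set w : C(X, ℝ) := h x • (h * g) with hw
  have hwv : ∀ y, w y = h x * h y * g y := fun y => by simp [hw]; ring
  have hw0 : ∀ y ∈ weightedSupport h L, 0 ≤ w y := fun y hy => by
    rw [hwv]
    rcases (abs_eq_abs.1 ((hsub hy).trans (hsub hx).symm)) with e | e
    · rw [e]
      exact mul_nonneg (mul_self_nonneg _) (hg0 y)
    · rw [hgK y ⟨hy, e⟩, mul_zero]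
  have hwx : 0 < w x := by
    rw [hwv, mul_self_of_mem_peakSet (hsub hx)]
    positivity
  have hLw : L (h * w) = 0 := by
    have hz : ∀ y ∈ peakSet h, (h * h * g - (‖h‖ * ‖h‖) • g) y = 0 := fun y hy => by
      simp [mul_self_of_mem_peakSet hy]
    have h1 := nonneg_of_nonneg_on_peakSet h0 hL
      (F := h * h * g - (‖h‖ * ‖h‖) • g) fun y hy => by rw [hz y hy, mul_zero]
    have h2 := nonneg_of_nonneg_on_peakSet h0 hL
      (F := -(h * h * g - (‖h‖ * ‖h‖) • g)) fun y hy => by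
        rw [ContinuousMap.neg_apply, hz y hy, neg_zero, mul_zero]
    rw [map_neg] at h2
    rw [map_sub, map_smul, hLA g hgA, smul_zero, sub_zero] at h1 h2
    have : h * w = h x • (h * h * g) := by rw [hw, mul_smul_comm, mul_assoc]
    rw [this, map_smul, le_antisymm (by linarith) h1, smul_zero]
  have hsup : 0 ≤ L (h * (w - w ⊔ 0)) :=
    nonneg_mul_of_nonneg_on_weightedSupport h0 hL fun y hy => by simp [hw0 y hy]
  rw [mul_sub, map_sub, hLw] at hsup
  have := hx (w ⊔ 0) (fun y => by simp) (by linarith)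
  have : w x ≤ (w ⊔ 0) x := by simp
  linarith

theorem exists_extremal_infiniteBolt (A₁ A₂ : Subalgebra ℝ C(X, ℝ))
    (hA₁ : IsClosed (A₁ : Set C(X, ℝ))) (hA₂ : IsClosed (A₂ : Set C(X, ℝ)))
    (h0 : h ≠ 0) (hbest : ∀ u ∈ algSum A₁ A₂, ‖h‖ ≤ ‖h - u‖) :
    ∃ x : ℕ → X, IsInfiniteBolt A₁ A₂ x ∧ ExtremalSeq h x := by
  obtain ⟨L, hLV, hL⟩ := exists_annihilating_functional
    (Subalgebra.toSubmodule A₁ ⊔ Subalgebra.toSubmodule A₂) h0 fun u hu => by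
      obtain ⟨a, ha, b, hb, rfl⟩ := Submodule.mem_sup.1 hu
      exact hbest _ ⟨a, ha, b, hb, rfl⟩
  have step₁ := fun x : weightedSupport h L => exists_algLink_neg h0 hL A₁ hA₁
    (fun g hg => hLV g (Submodule.mem_sup_left hg)) x.2
  have step₂ := fun x : weightedSupport h L => exists_algLink_neg h0 hL A₂ hA₂
    (fun g hg => hLV g (Submodule.mem_sup_right hg)) x.2
  choose n₁ hn₁ hl₁ hs₁ using step₁
  choose n₂ hn₂ hl₂ hs₂ using step₂
  obtain ⟨x₀, hx₀⟩ := weightedSupport_nonempty h0 hL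
  let z : ℕ → weightedSupport h L := fun n => Nat.rec ⟨x₀, hx₀⟩
    (fun k y => if Even k then ⟨n₁ y, hn₁ y⟩ else ⟨n₂ y, hn₂ y⟩) n
  have hz : ∀ k, z (k + 1) = if Even k then ⟨n₁ (z k), hn₁ _⟩ else ⟨n₂ (z k), hn₂ _⟩ :=
    fun _ => rfl
  have hsign : ∀ k : ℕ, h (z (k + 1)).1 = -h (z k).1 := fun k => by
    rw [hz]
    split_ifs
    · exact hs₁ (z k)
    · exact hs₂ (z k)
  have hpeak : ∀ k : ℕ, |h (z k).1| = ‖h‖ := fun k => weightedSupport_subset_peakSet h0 hL (z k).2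
  have hpow : ∀ k : ℕ, h (z k).1 = (-1) ^ k * h x₀ := fun k => by
    induction k with
    | zero => simp [z]
    | succ k ih => rw [hsign, ih]; ring
  refine ⟨fun k => (z k).1, ⟨fun k e => ?_, Or.inl fun k => ?_⟩, ?_⟩
  · have h1 := hsign k
    beta_reduce at e
    rw [← e] at h1
    have h2 : h (z k).1 = 0 := by linarith
    have h3 := hpeak k
    rw [h2, abs_zero] at h3
    exact h0 (norm_eq_zero.1 h3.symm)
  · beta_reduce
    rw [hz]
    split_ifs
    · exact hl₁ (z k)
    · exact hl₂ (z k)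
  · rcases eq_or_eq_neg_of_abs_eq (show |h x₀| = ‖h‖ from hpeak 0) with e | e
    · exact Or.inl fun k => by rw [hpow, e]
    · exact Or.inr fun k => by rw [hpow, e]; ring

end BoltExistence

section BoltLowerBound

variable {X : Type*} [TopologicalSpace X]

theorem IsInfiniteBolt.symm {A₁ A₂ : Subalgebra ℝ C(X, ℝ)} {x : ℕ → X}
    (hx : IsInfiniteBolt A₁ A₂ x) : IsInfiniteBolt A₂ A₁ x :=
  ⟨hx.1, hx.2.symm⟩

/-- Extending a closed bolt periodically gives an infinite bolt. -/
theorem IsClosedBolt.isInfiniteBolt {A₁ A₂ : Subalgebra ℝ C(X, ℝ)} {m : ℕ} {x : Fin m → X}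
    (hx : IsClosedBolt A₁ A₂ x) :
    IsInfiniteBolt A₁ A₂ fun i => x ⟨i % m, Nat.mod_lt _ hx.1⟩ := by
  obtain ⟨hm, hev, hne, hl⟩ := hx
  have hnext : ∀ i : ℕ, (⟨(i + 1) % m, Nat.mod_lt _ hm⟩ : Fin m) =
      nextIdx ⟨i % m, Nat.mod_lt _ hm⟩ := fun i => by simp [nextIdx]
  have hpar : ∀ i : ℕ, Even (i % m) ↔ Even i := fun i => hev.mod_even_iff
  refine ⟨fun i => ?_, hl.imp (fun H i => ?_) fun H i => ?_⟩
  · beta_reduce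
    rw [hnext]
    exact hne _
  · have := H ⟨i % m, Nat.mod_lt _ hm⟩
    beta_reduce
    rw [hnext]
    simpa only [hpar] using this
  · have := H ⟨i % m, Nat.mod_lt _ hm⟩
    beta_reduce
    rw [hnext]
    simpa only [hpar] using this

theorem ExtremalFin.extremalSeq [CompactSpace X] {h : C(X, ℝ)} {m : ℕ} (hm : 0 < m)
    (hev : Even m) {x : Fin m → X} (hx : ExtremalFin h x) :
    ExtremalSeq h fun i => x ⟨i % m, Nat.mod_lt _ hm⟩ := by
  have hpow : ∀ i : ℕ, (-1 : ℝ) ^ (i % m) = (-1) ^ i := fun i => by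
    conv_rhs => rw [← Nat.mod_add_div i m, pow_add, pow_mul, hev.neg_one_pow, one_pow, mul_one]
  refine hx.imp (fun H i => ?_) fun H i => ?_
  · rw [H, hpow]
  · rw [H, pow_succ, hpow, pow_succ]

theorem abs_alternating_sum_le (v : ℕ → ℝ) {C : ℝ} (hC : ∀ i, |v i| ≤ C) (p : ℕ → Prop)
    (hp : ∀ i, p i → ¬ p (i + 1)) (hp' : ∀ i, ¬ p i → p (i + 1))
    (hv : ∀ i, p i → v i = v (i + 1)) (n : ℕ) :
    |∑ i ∈ Finset.range n, (-1 : ℝ) ^ i * v i| ≤ 2 * C := by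
  have hC0 : 0 ≤ C := (abs_nonneg _).trans (hC 0)
  have key : ∀ n, (p n → |∑ i ∈ Finset.range n, (-1 : ℝ) ^ i * v i| ≤ C) ∧
      (¬ p n → |∑ i ∈ Finset.range n, (-1 : ℝ) ^ i * v i + (-1) ^ n * v n| ≤ C) := by
    intro n
    induction n with
    | zero => exact ⟨fun _ => by simpa using hC0, fun _ => by simpa using hC 0⟩
    | succ n ih =>
      refine ⟨fun hn => ?_, fun hn => ?_⟩
      · rw [Finset.sum_range_succ]
        exact ih.2 fun h => hp n h hn
      · have hpn : p n := by
          by_contra h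
          exact hn (hp' n h)
        have := ih.1 hpn
        rw [Finset.sum_range_succ, ← hv n hpn, pow_succ]
        simpa using this
  by_cases hn : p n
  · linarith [(key n).1 hn]
  · have h1 := (key n).2 hn
    have h2 : |(-1 : ℝ) ^ n * v n| ≤ C := by simpa [abs_mul] using hC n
    have h3 := abs_sub (∑ i ∈ Finset.range n, (-1 : ℝ) ^ i * v i + (-1) ^ n * v n)
      ((-1) ^ n * v n)
    rw [add_sub_cancel_right] at h3
    linarith

/-- An extremal infinite bolt bounds the distance to the sum of the algebras from below. -/
theorem ExtremalSeq.norm_le [CompactSpace X] {A₁ A₂ : Subalgebra ℝ C(X, ℝ)} {h : C(X, ℝ)}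
    {x : ℕ → X} (hx : ExtremalSeq h x) (hb : IsInfiniteBolt A₁ A₂ x) {u : C(X, ℝ)}
    (hu : u ∈ algSum A₁ A₂) : ‖h‖ ≤ ‖h - u‖ := by
  wlog hl : ∀ i : ℕ, if Even i then AlgLink A₁ (x i) (x (i + 1)) else AlgLink A₂ (x i) (x (i + 1))
    generalizing A₁ A₂
  · obtain ⟨a, ha, b, hb', rfl⟩ := hu
    exact this hb.symm ⟨b, hb', a, ha, add_comm _ _⟩ (hb.2.resolve_left hl)
  obtain ⟨a, ha, b, hb', rfl⟩ := hu
  have hsa := abs_alternating_sum_le (fun i => a (x i)) (fun i => a.norm_coe_le_norm (x i)) Even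
    (fun i => by grind) (fun i => by grind)
    (fun i hi => by have := hl i; rw [if_pos hi] at this; exact this a ha)
  have hsb := abs_alternating_sum_le (fun i => b (x i)) (fun i => b.norm_coe_le_norm (x i))
    (fun i => ¬ Even i) (fun i => by grind) (fun i => by grind)
    (fun i hi => by have := hl i; rw [if_neg hi] at this; exact this b hb')
  have hsh : ∀ n : ℕ, |∑ i ∈ Finset.range n, (-1 : ℝ) ^ i * h (x i)| = n * ‖h‖ := fun n => by
    have hsq : ∀ i : ℕ, (-1 : ℝ) ^ i * (-1) ^ i = 1 := fun i => by
      rw [← mul_pow]; simp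
    rcases hx with H | H
    · simp [H, ← mul_assoc, hsq]
    · simp [H, pow_succ, ← mul_assoc, hsq]
  have hsd : ∀ n : ℕ, |∑ i ∈ Finset.range n, (-1 : ℝ) ^ i * (h - (a + b)) (x i)| ≤
      n * ‖h - (a + b)‖ := fun n => by
    refine (Finset.abs_sum_le_sum_abs _ _).trans ?_
    refine (Finset.sum_le_card_nsmul _ _ ‖h - (a + b)‖ fun i _ => ?_).trans (by simp)
    rw [abs_mul, abs_neg_one_pow, one_mul]
    exact (h - (a + b)).norm_coe_le_norm (x i)
  by_contra! hlt
  obtain ⟨n, hn⟩ := exists_nat_gt ((2 * ‖a‖ + 2 * ‖b‖) / (‖h‖ - ‖h - (a + b)‖))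
  rw [div_lt_iff₀ (sub_pos.2 hlt)] at hn
  have hdecomp : ∑ i ∈ Finset.range n, (-1 : ℝ) ^ i * h (x i) =
      ∑ i ∈ Finset.range n, (-1 : ℝ) ^ i * (h - (a + b)) (x i) +
        (∑ i ∈ Finset.range n, (-1 : ℝ) ^ i * a (x i) +
          ∑ i ∈ Finset.range n, (-1 : ℝ) ^ i * b (x i)) := by
    rw [← Finset.sum_add_distrib, ← Finset.sum_add_distrib]
    refine Finset.sum_congr rfl fun i _ => ?_
    simp only [ContinuousMap.sub_apply, ContinuousMap.add_apply]
    ring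
  have h1 := hsh n
  rw [hdecomp] at h1
  have h2 := abs_add_le (∑ i ∈ Finset.range n, (-1 : ℝ) ^ i * (h - (a + b)) (x i))
    (∑ i ∈ Finset.range n, (-1 : ℝ) ^ i * a (x i) + ∑ i ∈ Finset.range n, (-1 : ℝ) ^ i * b (x i))
  have h3 := abs_add_le (∑ i ∈ Finset.range n, (-1 : ℝ) ^ i * a (x i))
    (∑ i ∈ Finset.range n, (-1 : ℝ) ^ i * b (x i))
  nlinarith [hsa n, hsb n, hsd n]

theorem norm_sub_eq_approxError_iff [CompactSpace X] {A₁ A₂ : Subalgebra ℝ C(X, ℝ)}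
    {f u₀ : C(X, ℝ)} (hu₀ : u₀ ∈ algSum A₁ A₂) :
    ‖f - u₀‖ = approxError A₁ A₂ f ↔ ∀ u ∈ algSum A₁ A₂, ‖f - u₀‖ ≤ ‖f - u₀ - u‖ := by
  have hbdd : BddBelow (Set.range fun u : algSum A₁ A₂ => ‖f - (u : C(X, ℝ))‖) :=
    ⟨0, by rintro _ ⟨u, rfl⟩; exact norm_nonneg _⟩
  obtain ⟨a, ha, b, hb, rfl⟩ := hu₀
  constructor
  · rintro h u ⟨c, hc, d, hd, rfl⟩
    rw [h, sub_sub]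
    exact ciInf_le hbdd (⟨a + b + (c + d), a + c, A₁.add_mem ha hc, b + d, A₂.add_mem hb hd,
      by abel⟩ : algSum A₁ A₂)
  · intro h
    have : Nonempty (algSum A₁ A₂) := ⟨⟨a + b, a, ha, b, hb, rfl⟩⟩
    refine le_antisymm (le_ciInf ?_) (ciInf_le hbdd (⟨a + b, a, ha, b, hb, rfl⟩ : algSum A₁ A₂))
    rintro ⟨_, c, hc, d, hd, rfl⟩
    have := h (c - a + (d - b)) ⟨_, A₁.sub_mem hc ha, _, A₂.sub_mem hd hb, rfl⟩
    rwa [show f - (a + b) - (c - a + (d - b)) = f - (c + d) by abel] at this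

end BoltLowerBound

theorem chebyshev_criterion_bestApproximation {X : Type*} [MetricSpace X] [CompactSpace X]
    (A₁ A₂ : Subalgebra ℝ C(X, ℝ))
    (hA₁ : IsClosed (A₁ : Set C(X, ℝ))) (hA₂ : IsClosed (A₂ : Set C(X, ℝ)))
    (f : C(X, ℝ)) (hf : f ∉ algSum A₁ A₂)
    (u₀ : C(X, ℝ)) (hu₀ : u₀ ∈ algSum A₁ A₂) :
    ‖f - u₀‖ = approxError A₁ A₂ f ↔
      ((∃ (m : ℕ) (x : Fin m → X), IsClosedBolt A₁ A₂ x ∧ ExtremalFin (f - u₀) x) ∨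
       (∃ x : ℕ → X, IsInfiniteBolt A₁ A₂ x ∧ ExtremalSeq (f - u₀) x)) := by
  rw [norm_sub_eq_approxError_iff hu₀]
  constructor
  · intro hbest
    refine Or.inr (exists_extremal_infiniteBolt A₁ A₂ hA₁ hA₂ (fun h => hf ?_) hbest)
    rwa [sub_eq_zero.1 h]
  · rintro (⟨m, x, hb, hx⟩ | ⟨x, hb, hx⟩) u hu
    · exact (hx.extremalSeq hb.1 hb.2.1).norm_le hb.isInfiniteBolt hu
    · exact hx.norm_le hb hu
end

section
/- Let X be a compact metric space, let A₁ and A₂ be closed subalgebras of C(X) containing the constants, and let l be a closed bolt with respect to A₁ and A₂. Then for every f ∈ C(X), |r_l(f)| ≤ E(f). Consequently, the supremum of |r_l(f)| over all closed bolts l ⊂ X is at most E(f). -/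
open Filter Topology

theorem nextIdx_bijective {m : ℕ} : Function.Bijective (nextIdx : Fin m → Fin m) := by
  refine Finite.injective_iff_bijective.mp fun a b hab => ?_
  have h : (a : ℕ) + 1 ≡ b + 1 [MOD m] := congrArg Fin.val hab
  exact Fin.ext ((Nat.ModEq.add_right_cancel' 1 h).eq_of_lt_of_lt a.isLt b.isLt)

theorem neg_one_pow_nextIdx {m : ℕ} (hm : Even m) (i : Fin m) :
    (-1 : ℝ) ^ (nextIdx i : ℕ) = -(-1) ^ (i : ℕ) := by
  rw [← mul_neg_one ((-1 : ℝ) ^ (i : ℕ)), ← pow_succ]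
  rcases Nat.lt_or_ge ((i : ℕ) + 1) m with h | h
  · simp [nextIdx, Nat.mod_eq_of_lt h]
  · have h' : (i : ℕ) + 1 = m := le_antisymm i.isLt h
    simp [nextIdx, h', hm.neg_one_pow]

/-- An alternating cyclic sum vanishes if the summands agree along every link starting at an
index of one fixed parity, encoded by the sign `e`. -/
theorem alternating_sum_eq_zero {m : ℕ} (hm : Even m) (u : Fin m → ℝ) {e : ℝ} (he : e ≠ 0)
    (hu : ∀ i : Fin m, (1 + e * (-1) ^ (i : ℕ)) * u i = (1 + e * (-1) ^ (i : ℕ)) * u (nextIdx i)) :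
    ∑ i : Fin m, (-1 : ℝ) ^ (i : ℕ) * u i = 0 := by
  have h : ∑ i : Fin m, (1 + e * (-1) ^ (i : ℕ)) * u i =
      ∑ i : Fin m, (1 - e * (-1) ^ (i : ℕ)) * u i := by
    rw [← nextIdx_bijective.sum_comp fun i : Fin m => (1 - e * (-1) ^ (i : ℕ)) * u i]
    refine Finset.sum_congr rfl fun i _ => ?_
    rw [hu, neg_one_pow_nextIdx hm]
    ring
  have h' : 2 * e * ∑ i : Fin m, (-1 : ℝ) ^ (i : ℕ) * u i = 0 := by
    rw [← sub_eq_zero.mpr h, ← Finset.sum_sub_distrib, Finset.mul_sum]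
    exact Finset.sum_congr rfl fun i _ => by ring
  simpa [he] using h'

theorem alternating_sum_eq_zero_of_even {m : ℕ} (hm : Even m) (u : Fin m → ℝ)
    (hu : ∀ i : Fin m, Even (i : ℕ) → u i = u (nextIdx i)) :
    ∑ i : Fin m, (-1 : ℝ) ^ (i : ℕ) * u i = 0 := by
  refine alternating_sum_eq_zero hm u one_ne_zero fun i => ?_
  rcases Nat.even_or_odd (i : ℕ) with h | h
  · rw [hu i h]
  · simp [h.neg_one_pow]

theorem alternating_sum_eq_zero_of_odd {m : ℕ} (hm : Even m) (u : Fin m → ℝ)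
    (hu : ∀ i : Fin m, ¬ Even (i : ℕ) → u i = u (nextIdx i)) :
    ∑ i : Fin m, (-1 : ℝ) ^ (i : ℕ) * u i = 0 := by
  refine alternating_sum_eq_zero hm u (neg_ne_zero.mpr one_ne_zero) fun i => ?_
  by_cases h : Even (i : ℕ)
  · simp [h.neg_one_pow]
  · rw [hu i h]

theorem boltFun_add {X : Type*} [TopologicalSpace X] {n : ℕ} (x : Fin n → X) (F G : C(X, ℝ)) :
    boltFun x (F + G) = boltFun x F + boltFun x G := by
  simp [boltFun, mul_add, Finset.sum_add_distrib]

/-- The functional of a closed bolt annihilates `A₁ + A₂`. -/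
theorem IsClosedBolt.boltFun_eq_zero {X : Type*} [TopologicalSpace X]
    {A₁ A₂ : Subalgebra ℝ C(X, ℝ)} {m : ℕ} {x : Fin m → X} (hx : IsClosedBolt A₁ A₂ x)
    {u : C(X, ℝ)} (hu : u ∈ algSum A₁ A₂) : boltFun x u = 0 := by
  obtain ⟨g, hg, h, hh, rfl⟩ := hu
  obtain ⟨-, hm, -, H | H⟩ := hx
  · have h₁ := alternating_sum_eq_zero_of_even hm (fun i => g (x i)) fun i hi => by
      have := H i
      rw [if_pos hi] at this
      exact this g hg
    have h₂ := alternating_sum_eq_zero_of_odd hm (fun i => h (x i)) fun i hi => by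
      have := H i
      rw [if_neg hi] at this
      exact this h hh
    rw [boltFun_add, boltFun, boltFun, h₁, h₂]
    simp
  · have h₁ := alternating_sum_eq_zero_of_odd hm (fun i => g (x i)) fun i hi => by
      have := H i
      rw [if_neg hi] at this
      exact this g hg
    have h₂ := alternating_sum_eq_zero_of_even hm (fun i => h (x i)) fun i hi => by
      have := H i
      rw [if_pos hi] at this
      exact this h hh
    rw [boltFun_add, boltFun, boltFun, h₁, h₂]
    simp

theorem abs_boltFun_le_norm {X : Type*} [TopologicalSpace X] [CompactSpace X] {n : ℕ}
    (x : Fin n → X) (F : C(X, ℝ)) : |boltFun x F| ≤ ‖F‖ := by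
  rcases Nat.eq_zero_or_pos n with rfl | hn
  · simp [boltFun]
  have hn' : (0 : ℝ) < n := Nat.cast_pos.mpr hn
  rw [boltFun, abs_mul, abs_of_pos (inv_pos.mpr hn'), inv_mul_le_iff₀ hn']
  calc |∑ i : Fin n, (-1 : ℝ) ^ (i : ℕ) * F (x i)|
      ≤ ∑ i : Fin n, |(-1 : ℝ) ^ (i : ℕ) * F (x i)| := Finset.abs_sum_le_sum_abs _ _
    _ ≤ ∑ _i : Fin n, ‖F‖ := Finset.sum_le_sum fun i _ => by
        simpa [abs_mul] using F.norm_coe_le_norm (x i)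
    _ = n * ‖F‖ := by simp

theorem IsClosedBolt.abs_boltFun_le {X : Type*} [TopologicalSpace X] [CompactSpace X]
    {A₁ A₂ : Subalgebra ℝ C(X, ℝ)} {m : ℕ} {x : Fin m → X} (hx : IsClosedBolt A₁ A₂ x)
    (f : C(X, ℝ)) : |boltFun x f| ≤ approxError A₁ A₂ f := by
  have : Nonempty (algSum A₁ A₂) := ⟨⟨0 + 0, 0, A₁.zero_mem, 0, A₂.zero_mem, rfl⟩⟩
  refine le_ciInf fun u => ?_
  have h : boltFun x f = boltFun x (f - (u : C(X, ℝ))) := by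
    conv_lhs => rw [← sub_add_cancel f (u : C(X, ℝ)), boltFun_add, hx.boltFun_eq_zero u.2, add_zero]
  rw [h]
  exact abs_boltFun_le_norm x _

theorem boltFunctional_le_approxError {X : Type*} [MetricSpace X] [CompactSpace X]
    (A₁ A₂ : Subalgebra ℝ C(X, ℝ))
    (hA₁ : IsClosed (A₁ : Set C(X, ℝ))) (hA₂ : IsClosed (A₂ : Set C(X, ℝ)))
    {m : ℕ} (x : Fin m → X) (hx : IsClosedBolt A₁ A₂ x) (f : C(X, ℝ)) :
    |boltFun x f| ≤ approxError A₁ A₂ f ∧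
    sSup {r : ℝ | ∃ (k : ℕ) (y : Fin k → X), IsClosedBolt A₁ A₂ y ∧ r = |boltFun y f|}
      ≤ approxError A₁ A₂ f := by
  refine ⟨hx.abs_boltFun_le f, csSup_le ⟨_, m, x, hx, rfl⟩ ?_⟩
  rintro _ ⟨k, y, hy, rfl⟩
  exact hy.abs_boltFun_le f
end

section
/- Let X be a compact metric space, let A₁ and A₂ be closed subalgebras of C(X) containing the constants, and let f ∈ C(X). For every infinite bolt l = {x₁, x₂, ...} with respect to A₁ and A₂, with finite initial segments l_n = {x₁,...,x_n}, one has limsup_{n→∞} |r_{l_n}(f)| ≤ E(f). -/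
open Filter Topology

/-- An alternating sum over a sequence whose terms agree in the pairs `(0, 1), (2, 3), ...`
telescopes. -/
theorem sum_alternating_eq_of_even_link {a : ℕ → ℝ} (h : ∀ i, Even i → a i = a (i + 1)) (n : ℕ) :
    ∑ i ∈ Finset.range n, (-1 : ℝ) ^ i * a i = if Even n then 0 else a n := by
  induction n with
  | zero => simp
  | succ n ih =>
    rw [Finset.sum_range_succ, ih]
    rcases Nat.even_or_odd n with hn | hn
    · simp [hn, hn.neg_one_pow, Nat.even_add_one, h n hn]
    · simp [Nat.not_even_iff_odd.mpr hn, hn.neg_one_pow, Nat.even_add_one]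

theorem abs_sum_alternating_le_of_even_link {a : ℕ → ℝ} {M : ℝ} (hM : ∀ i, |a i| ≤ M)
    (h : ∀ i, Even i → a i = a (i + 1)) (n : ℕ) :
    |∑ i ∈ Finset.range n, (-1 : ℝ) ^ i * a i| ≤ M := by
  rw [sum_alternating_eq_of_even_link h]
  split_ifs
  · simpa using (abs_nonneg _).trans (hM 0)
  · exact hM n

theorem abs_sum_alternating_le_of_odd_link {a : ℕ → ℝ} {M : ℝ} (hM : ∀ i, |a i| ≤ M)
    (h : ∀ i, ¬ Even i → a i = a (i + 1)) (n : ℕ) :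
    |∑ i ∈ Finset.range n, (-1 : ℝ) ^ i * a i| ≤ 2 * M := by
  have hM0 : 0 ≤ M := (abs_nonneg _).trans (hM 0)
  cases n with
  | zero => simpa using hM0
  | succ n =>
    have hs : ∑ i ∈ Finset.range (n + 1), (-1 : ℝ) ^ i * a i
        = a 0 - ∑ i ∈ Finset.range n, (-1 : ℝ) ^ i * a (i + 1) := by
      rw [Finset.sum_range_succ', sub_eq_neg_add, ← Finset.sum_neg_distrib]
      simp [pow_succ]
    have hb := abs_sum_alternating_le_of_even_link (a := fun i => a (i + 1))
      (fun i => hM (i + 1)) (fun i hi => h (i + 1) (by simpa [Nat.even_add_one] using hi)) n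
    rw [hs]
    exact (abs_sub _ _).trans (by linarith [hM 0])

/-- The alternating sums of an element of `A₁ + A₂` along an infinite bolt are bounded. -/
theorem IsInfiniteBolt.exists_abs_sum_le {X : Type*} [TopologicalSpace X] [CompactSpace X]
    {A₁ A₂ : Subalgebra ℝ C(X, ℝ)} {x : ℕ → X} (hx : IsInfiniteBolt A₁ A₂ x)
    {u : C(X, ℝ)} (hu : u ∈ algSum A₁ A₂) :
    ∃ C : ℝ, ∀ n, |∑ i ∈ Finset.range n, (-1 : ℝ) ^ i * u (x i)| ≤ C := by
  obtain ⟨g, hg, k, hk, rfl⟩ := hu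
  have norm_le (v : C(X, ℝ)) (i : ℕ) : |v (x i)| ≤ ‖v‖ := v.norm_coe_le_norm (x i)
  have add_le {C D : ℝ} (n : ℕ) (hC : |∑ i ∈ Finset.range n, (-1 : ℝ) ^ i * g (x i)| ≤ C)
      (hD : |∑ i ∈ Finset.range n, (-1 : ℝ) ^ i * k (x i)| ≤ D) :
      |∑ i ∈ Finset.range n, (-1 : ℝ) ^ i * (g + k) (x i)| ≤ C + D := by
    simp only [ContinuousMap.add_apply, mul_add, Finset.sum_add_distrib]
    exact (abs_add_le _ _).trans (add_le_add hC hD)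
  rcases hx.2 with h | h
  · refine ⟨‖g‖ + 2 * ‖k‖, fun n => add_le n ?_ ?_⟩
    · refine abs_sum_alternating_le_of_even_link (norm_le g) (fun i hi => ?_) n
      have := h i
      rw [if_pos hi] at this
      exact this g hg
    · refine abs_sum_alternating_le_of_odd_link (norm_le k) (fun i hi => ?_) n
      have := h i
      rw [if_neg hi] at this
      exact this k hk
  · refine ⟨2 * ‖g‖ + ‖k‖, fun n => add_le n ?_ ?_⟩
    · refine abs_sum_alternating_le_of_odd_link (norm_le g) (fun i hi => ?_) n
      have := h i
      rw [if_neg hi] at this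
      exact this g hg
    · refine abs_sum_alternating_le_of_even_link (norm_le k) (fun i hi => ?_) n
      have := h i
      rw [if_pos hi] at this
      exact this k hk

theorem limsup_boltFunctional_le_approxError {X : Type*} [MetricSpace X] [CompactSpace X]
    (A₁ A₂ : Subalgebra ℝ C(X, ℝ))
    (hA₁ : IsClosed (A₁ : Set C(X, ℝ))) (hA₂ : IsClosed (A₂ : Set C(X, ℝ)))
    (f : C(X, ℝ)) (x : ℕ → X) (hx : IsInfiniteBolt A₁ A₂ x) :
    Filter.limsup (fun n : ℕ => |boltFun (fun i : Fin n => x (i : ℕ)) f|) atTop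
      ≤ approxError A₁ A₂ f := by
  have : Nonempty (algSum A₁ A₂) := ⟨⟨0, 0, A₁.zero_mem, 0, A₂.zero_mem, by simp⟩⟩
  refine le_ciInf fun ⟨u, hu⟩ => ?_
  obtain ⟨C, hC⟩ := hx.exists_abs_sum_le hu
  have hlim : Tendsto (fun n : ℕ => ‖f - u‖ + (n : ℝ)⁻¹ * C) atTop (𝓝 ‖f - u‖) := by
    simpa using tendsto_const_nhds.add
      ((tendsto_inv_atTop_nhds_zero_nat (𝕜 := ℝ)).mul_const C)
  have hle (n : ℕ) : |boltFun (fun i : Fin n => x (i : ℕ)) f| ≤ ‖f - u‖ + (n : ℝ)⁻¹ * C := by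
    have hsplit : boltFun (fun i : Fin n => x (i : ℕ)) f
        = boltFun (fun i : Fin n => x (i : ℕ)) (f - u)
          + (n : ℝ)⁻¹ * ∑ i ∈ Finset.range n, (-1 : ℝ) ^ i * u (x i) := by
      rw [Finset.sum_range, boltFun, boltFun, ← mul_add, ← Finset.sum_add_distrib]
      simp [← mul_add]
    rw [hsplit]
    refine (abs_add_le _ _).trans (add_le_add (abs_boltFun_le_norm _ _) ?_)
    rw [abs_mul, abs_of_nonneg (by positivity)]
    exact mul_le_mul_of_nonneg_left (hC n) (by positivity)
  calc limsup (fun n : ℕ => |boltFun (fun i : Fin n => x (i : ℕ)) f|) atTop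
      ≤ limsup (fun n : ℕ => ‖f - u‖ + (n : ℝ)⁻¹ * C) atTop :=
        limsup_le_limsup (Eventually.of_forall hle)
          (isCoboundedUnder_le_of_le atTop fun n => abs_nonneg _) hlim.isBoundedUnder_le
    _ = ‖f - u‖ := hlim.limsup_eq
end
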